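/- Let p, q : [0,1) → ℝ be continuous with ∫₀¹|p(x)|dx < ∞ and ∫₀¹|q(x)|dx < ∞, let ξ ∈ [0,1) and η ∈ ℝ. Then there exists n* ∈ ℕ such that for every n ≥ n* the discretized integral equation of order n has at least one solution, i.e. there exist real coefficients c_0,…,c_{2^n−1} such that ȳ_n = Σ_{k=0}^{2^n−1} c_k ω_k satisfies ȳ_n(x) = η + S_{2^n}( ∫_ξ^{·} (S_{2^n}q(t) − S_{2^n}p(t) ȳ_n(t)) dt )(x) for all x ∈ [0,1). -/

import Mathlib

open MeasureTheory Matrix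

/-- The `k`-th binary digit of `x ∈ [0,1)`, using the expansion terminating in zeros
for dyadic rationals. -/
noncomputable def binDigit (k : ℕ) (x : ℝ) : ℕ := ⌊x * 2 ^ (k + 1)⌋.toNat % 2

/-- Rademacher functions `r_k(x) = (-1)^{x_k}`. -/
noncomputable def rademacher (k : ℕ) (x : ℝ) : ℝ := (-1 : ℝ) ^ binDigit k x

/-- Walsh–Paley functions `ω_n(x) = ∏_k r_k(x)^{n_k}`. -/
noncomputable def walsh (n : ℕ) (x : ℝ) : ℝ :=
  ∏ k ∈ Finset.range n, if n.testBit k then rademacher k x else 1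

/-- Walsh–Fourier coefficient `f̂_k = ∫₀¹ f ω_k`. -/
noncomputable def fcoef (f : ℝ → ℝ) (k : ℕ) : ℝ := ∫ x in (0:ℝ)..1, f x * walsh k x

/-- The `2^n`-th partial sum of the Walsh–Fourier series:
`S_{2^n} f (x) = ∑_{k<2^n} f̂_k ω_k(x)`. -/
noncomputable def S2 (n : ℕ) (f : ℝ → ℝ) (x : ℝ) : ℝ :=
  ∑ k ∈ Finset.range (2 ^ n), fcoef f k * walsh k x


open Finset in
theorem sum_prod_testBit (n : ℕ) (g : ℕ → ℝ) :
    ∑ k ∈ range (2 ^ n), ∏ j ∈ range n, (if k.testBit j then g j else 1) =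
      ∏ j ∈ range n, (1 + g j) := by
  induction n with
  | zero => simp
  | succ n ih =>
    have hlow : ∑ k ∈ range (2 ^ n), ∏ j ∈ range (n + 1), (if k.testBit j then g j else 1) =
        ∑ k ∈ range (2 ^ n), ∏ j ∈ range n, (if k.testBit j then g j else 1) := by
      refine sum_congr rfl fun k hk => ?_
      simp [prod_range_succ, Nat.testBit_lt_two_pow (mem_range.1 hk)]
    have hhigh : ∑ k ∈ range (2 ^ n),
          ∏ j ∈ range (n + 1), (if (2 ^ n + k).testBit j then g j else 1) =
        (∑ k ∈ range (2 ^ n), ∏ j ∈ range n, (if k.testBit j then g j else 1)) * g n := by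
      rw [sum_mul]
      refine sum_congr rfl fun k hk => ?_
      rw [prod_range_succ, Nat.testBit_two_pow_add_eq,
        Nat.testBit_lt_two_pow (mem_range.1 hk)]
      simp only [Bool.not_false, if_true]
      congr 1
      refine prod_congr rfl fun j hj => ?_
      rw [Nat.testBit_two_pow_add_gt (mem_range.1 hj)]
    rw [pow_succ, mul_two, sum_range_add, hlow, hhigh, ih, prod_range_succ]
    ring

open Finset in
theorem walsh_eq_prod_range {n k : ℕ} (hk : k < 2 ^ n) (x : ℝ) :
    walsh k x = ∏ j ∈ range n, if k.testBit j then rademacher j x else 1 := by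
  have hbit : ∀ m, k < 2 ^ m → ∀ j, m ≤ j → k.testBit j = false := fun m hm j hj =>
    Nat.testBit_lt_two_pow (hm.trans_le (Nat.pow_le_pow_right two_pos hj))
  have hext : ∀ m, k < 2 ^ m →
      ∏ j ∈ range m, (if k.testBit j then rademacher j x else 1) =
        ∏ j ∈ range (max k n), if k.testBit j then rademacher j x else 1 := by
    intro m hm
    by_cases h : m ≤ max k n
    · refine prod_subset (range_mono h) fun j _ hj => ?_
      simp [hbit m hm j (by simpa using hj)]
    · refine (prod_subset (range_mono (by omega)) fun j _ hj => ?_).symm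
      simp only [mem_range, not_lt] at hj
      simp [hbit n hk j (by omega)]
  rw [walsh, hext k Nat.lt_two_pow_self, hext n hk]

theorem floor_mul_two_pow_succ (x : ℝ) (n : ℕ) :
    ⌊x * 2 ^ (n + 1)⌋₊ = 2 * ⌊x * 2 ^ n⌋₊ + binDigit n x := by
  have h : ⌊x * 2 ^ n⌋₊ = ⌊x * 2 ^ (n + 1)⌋₊ / 2 := by
    rw [← Nat.floor_div_ofNat, show x * 2 ^ n = x * 2 ^ (n + 1) / 2 by ring]
  have h2 : binDigit n x = ⌊x * 2 ^ (n + 1)⌋₊ % 2 := by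
    rw [binDigit, Int.floor_toNat]
  omega

theorem one_add_rademacher_mul (k : ℕ) (x t : ℝ) :
    1 + rademacher k x * rademacher k t = if binDigit k x = binDigit k t then 2 else 0 := by
  have hx : binDigit k x < 2 := Nat.mod_lt _ two_pos
  have ht : binDigit k t < 2 := Nat.mod_lt _ two_pos
  unfold rademacher
  generalize binDigit k x = a at *
  generalize binDigit k t = b at *
  interval_cases a <;> interval_cases b <;> norm_num

open Finset in
theorem prod_one_add_rademacher_mul (n : ℕ) {x t : ℝ} (hx : x ∈ Set.Ico (0 : ℝ) 1)
    (ht : t ∈ Set.Ico (0 : ℝ) 1) :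
    ∏ k ∈ range n, (1 + rademacher k x * rademacher k t) =
      if ⌊t * 2 ^ n⌋₊ = ⌊x * 2 ^ n⌋₊ then 2 ^ n else 0 := by
  induction n with
  | zero => simp [Nat.floor_eq_zero.2 hx.2, Nat.floor_eq_zero.2 ht.2]
  | succ n ih =>
    have hdx : binDigit n x < 2 := Nat.mod_lt _ two_pos
    have hdt : binDigit n t < 2 := Nat.mod_lt _ two_pos
    rw [prod_range_succ, ih, one_add_rademacher_mul, floor_mul_two_pow_succ, floor_mul_two_pow_succ]
    split_ifs <;> first | omega | ring

open Finset in
/-- The Dirichlet kernel of order `2 ^ n` of the Walsh system. -/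
theorem sum_walsh_mul_walsh (n : ℕ) {x t : ℝ} (hx : x ∈ Set.Ico (0 : ℝ) 1)
    (ht : t ∈ Set.Ico (0 : ℝ) 1) :
    ∑ k ∈ range (2 ^ n), walsh k x * walsh k t =
      if ⌊t * 2 ^ n⌋₊ = ⌊x * 2 ^ n⌋₊ then 2 ^ n else 0 := by
  rw [← prod_one_add_rademacher_mul n hx ht, ← sum_prod_testBit]
  refine sum_congr rfl fun k hk => ?_
  rw [walsh_eq_prod_range (mem_range.1 hk), walsh_eq_prod_range (mem_range.1 hk),
    ← prod_mul_distrib]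
  refine prod_congr rfl fun j _ => ?_
  split_ifs <;> simp

theorem measurable_walsh (k : ℕ) : Measurable (walsh k) := by
  have hd : ∀ j, Measurable (binDigit j) := fun j =>
    (measurable_of_countable fun m : ℤ => m.toNat % 2).comp
      (Int.measurable_floor.comp (measurable_id.mul_const _))
  have hr : ∀ j, Measurable (rademacher j) := fun j =>
    (measurable_of_countable fun m : ℕ => (-1 : ℝ) ^ m).comp (hd j)
  unfold walsh
  refine Finset.measurable_prod _ fun j _ => ?_
  split_ifs
  exacts [hr j, measurable_const]

theorem abs_walsh (k : ℕ) (x : ℝ) : |walsh k x| = 1 := by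
  rw [walsh, Finset.abs_prod]
  refine Finset.prod_eq_one fun j _ => ?_
  split_ifs <;> simp [rademacher]

theorem exists_trapezoid_recursion (a b : ℕ → ℝ) (N : ℕ) (ha : ∀ i < N, |a i| < 2)
    {j : ℕ} (hj : j < N) {θ : ℝ} (hθ : θ ∈ Set.Ico (0 : ℝ) 1) (η : ℝ) :
    ∃ Z y : ℕ → ℝ, (∀ i < N, Z (i + 1) = Z i + (b i - a i * y i)) ∧
      (∀ i, y i = (Z i + Z (i + 1)) / 2) ∧ Z j + θ * (b j - a j * y j) = η := by
  have ha' : ∀ i < N, 0 < 1 + a i / 2 ∧ 0 < 1 - a i / 2 := fun i hi => by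
    have := abs_lt.1 (ha i hi)
    constructor <;> linarith
  let α : ℕ → ℝ := fun i => Nat.rec 1 (fun i r => (1 - a i / 2) * r / (1 + a i / 2)) i
  let β : ℕ → ℝ := fun i => Nat.rec 0 (fun i r => ((1 - a i / 2) * r + b i) / (1 + a i / 2)) i
  have hα : ∀ i, α (i + 1) = (1 - a i / 2) * α i / (1 + a i / 2) := fun i => rfl
  have hβ : ∀ i, β (i + 1) = ((1 - a i / 2) * β i + b i) / (1 + a i / 2) := fun i => rfl
  have hpos : ∀ i ≤ N, 0 < α i := by
    intro i
    induction i with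
    | zero => intro _; exact one_pos
    | succ i ih =>
      intro hi
      rw [hα]
      exact div_pos (mul_pos (ha' i hi).2 (ih (by omega))) (ha' i hi).1
  have hden : 0 < (1 - θ) * α j + θ * α (j + 1) := by
    have h1 := mul_pos (sub_pos.2 hθ.2) (hpos j hj.le)
    have h2 := mul_nonneg hθ.1 (hpos (j + 1) hj).le
    linarith
  let z := (η - ((1 - θ) * β j + θ * β (j + 1))) / ((1 - θ) * α j + θ * α (j + 1))
  have hz : z * ((1 - θ) * α j + θ * α (j + 1)) = η - ((1 - θ) * β j + θ * β (j + 1)) :=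
    div_mul_cancel₀ _ hden.ne'
  let Z : ℕ → ℝ := fun i => α i * z + β i
  have hrec : ∀ i < N, Z (i + 1) = Z i + (b i - a i * ((Z i + Z (i + 1)) / 2)) := by
    intro i hi
    have hne := (ha' i hi).1.ne'
    have h : Z (i + 1) * (1 + a i / 2) = (1 - a i / 2) * Z i + b i := by
      have h1 : α (i + 1) * (1 + a i / 2) = (1 - a i / 2) * α i := div_mul_cancel₀ _ hne
      have h2 : β (i + 1) * (1 + a i / 2) = (1 - a i / 2) * β i + b i := div_mul_cancel₀ _ hne
      simp only [Z]
      linear_combination z * h1 + h2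
    linear_combination h
  refine ⟨Z, fun i => (Z i + Z (i + 1)) / 2, hrec, fun _ => rfl, ?_⟩
  have h := hrec j hj
  simp only [Z] at h ⊢
  linear_combination hz - θ * h

theorem floor_mul_two_pow_eq_iff (n : ℕ) {t : ℝ} (ht : 0 ≤ t) (i : ℕ) :
    ⌊t * 2 ^ n⌋₊ = i ↔ t ∈ Set.Ico ((i : ℝ) / 2 ^ n) ((i + 1) / 2 ^ n) := by
  rw [Nat.floor_eq_iff (by positivity), Set.mem_Ico, div_le_iff₀ (by positivity),
    lt_div_iff₀ (by positivity)]

theorem floor_mul_two_pow_lt (n : ℕ) {t : ℝ} (ht : t ∈ Set.Ico (0 : ℝ) 1) :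
    ⌊t * 2 ^ n⌋₊ < 2 ^ n := by
  rw [Nat.floor_lt (mul_nonneg ht.1 (by positivity))]
  push_cast
  exact mul_lt_of_lt_one_left (by positivity) ht.2

theorem Ico_dyadic_subset {n i : ℕ} (hi : i < 2 ^ n) :
    Set.Ico ((i : ℝ) / 2 ^ n) ((i + 1) / 2 ^ n) ⊆ Set.Ico 0 1 := by
  have h : (i : ℝ) + 1 ≤ 2 ^ n := mod_cast hi
  exact Set.Ico_subset_Ico (by positivity) ((div_le_one (by positivity)).2 h)

theorem dyadic_le (n i : ℕ) : (i : ℝ) / 2 ^ n ≤ (i + 1) / 2 ^ n := by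
  gcongr
  linarith

/-- The partial sum `S_{2^n} f` averages `f` over dyadic intervals of length `2 ^ (-n)`. -/
theorem S2_apply (n : ℕ) {f : ℝ → ℝ} (hf : IntervalIntegrable f volume 0 1) {x : ℝ}
    (hx : x ∈ Set.Ico (0 : ℝ) 1) :
    S2 n f x = 2 ^ n *
      ∫ t in ((⌊x * 2 ^ n⌋₊ : ℝ) / 2 ^ n)..((⌊x * 2 ^ n⌋₊ + 1) / 2 ^ n), f t := by
  have hint : ∀ k, IntervalIntegrable (fun t => f t * walsh k t * walsh k x) volume 0 1 := by
    intro k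
    rw [intervalIntegrable_iff] at hf ⊢
    exact (Integrable.mul_bdd (c := 1) hf (measurable_walsh k).aestronglyMeasurable
      (.of_forall fun t => by rw [Real.norm_eq_abs, abs_walsh])).mul_const _
  set i := ⌊x * 2 ^ n⌋₊ with hi
  set s := Set.Ico ((i : ℝ) / 2 ^ n) ((i + 1) / 2 ^ n) with hs
  have hsub : s ⊆ Set.Ico 0 1 := Ico_dyadic_subset (floor_mul_two_pow_lt n hx)
  calc S2 n f x
      = ∑ k ∈ Finset.range (2 ^ n), ∫ t in (0 : ℝ)..1, f t * walsh k t * walsh k x := by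
        simp only [S2, fcoef, intervalIntegral.integral_mul_const]
    _ = ∫ t in (0 : ℝ)..1, ∑ k ∈ Finset.range (2 ^ n), f t * walsh k t * walsh k x :=
        (intervalIntegral.integral_finsetSum fun k _ => hint k).symm
    _ = ∫ t in (0 : ℝ)..1, s.indicator (fun t => 2 ^ n * f t) t := by
        refine intervalIntegral.integral_congr_Ioo_of_le zero_le_one fun t ht => ?_
        have ht' : t ∈ Set.Ico (0 : ℝ) 1 := Set.Ioo_subset_Ico_self ht
        have h := sum_walsh_mul_walsh n hx ht'
        simp only [← hi, floor_mul_two_pow_eq_iff n ht'.1] at h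
        simp only [Set.indicator_apply, hs]
        trans f t * ∑ k ∈ Finset.range (2 ^ n), walsh k x * walsh k t
        · rw [Finset.mul_sum]
          exact Finset.sum_congr rfl fun k _ => by ring
        · rw [h]
          split_ifs <;> ring
    _ = ∫ t in s, 2 ^ n * f t := by
        rw [intervalIntegral.integral_of_le zero_le_one, ← integral_Ico_eq_integral_Ioc,
          setIntegral_indicator measurableSet_Ico, Set.inter_eq_self_of_subset_right hsub]
    _ = _ := by
        rw [integral_Ico_eq_integral_Ioc, ← intervalIntegral.integral_of_le (dyadic_le n i),
          intervalIntegral.integral_const_mul]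

section DyadicStep

variable {n : ℕ} {u : ℕ → ℝ} {F : ℝ → ℝ}

theorem dyadicStep_eqOn (hF : ∀ t ∈ Set.Ico (0 : ℝ) 1, F t = u ⌊t * 2 ^ n⌋₊) {i : ℕ}
    (hi : i < 2 ^ n) : Set.EqOn F (fun _ => u i) (Set.Ico ((i : ℝ) / 2 ^ n) ((i + 1) / 2 ^ n)) := by
  intro t ht
  have ht' := Ico_dyadic_subset hi ht
  rw [hF t ht', (floor_mul_two_pow_eq_iff n ht'.1 i).2 ht]

theorem intervalIntegrable_dyadicStep_cell
    (hF : ∀ t ∈ Set.Ico (0 : ℝ) 1, F t = u ⌊t * 2 ^ n⌋₊) {i : ℕ} (hi : i < 2 ^ n) :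
    IntervalIntegrable F volume ((i : ℝ) / 2 ^ n) ((i + 1) / 2 ^ n) := by
  refine (intervalIntegrable_const (c := u i)).congr_uIoo fun t ht => ?_
  rw [Set.uIoo_of_le (dyadic_le n i)] at ht
  exact (dyadicStep_eqOn hF hi (Set.Ioo_subset_Ico_self ht)).symm

theorem intervalIntegrable_dyadicStep
    (hF : ∀ t ∈ Set.Ico (0 : ℝ) 1, F t = u ⌊t * 2 ^ n⌋₊) :
    IntervalIntegrable F volume 0 1 := by
  have h := IntervalIntegrable.trans_iterate (f := F) (μ := volume)
    (a := fun k : ℕ => (k : ℝ) / 2 ^ n) (n := 2 ^ n) fun k hk => by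
      simpa using intervalIntegrable_dyadicStep_cell hF hk
  simpa using h

theorem integral_dyadicStep_cell
    (hF : ∀ t ∈ Set.Ico (0 : ℝ) 1, F t = u ⌊t * 2 ^ n⌋₊) {i : ℕ} (hi : i < 2 ^ n) {s : ℝ}
    (hs : s ∈ Set.Icc ((i : ℝ) / 2 ^ n) ((i + 1) / 2 ^ n)) :
    ∫ t in ((i : ℝ) / 2 ^ n)..s, F t = (s - i / 2 ^ n) * u i := by
  rw [intervalIntegral.integral_congr_Ioo_of_le hs.1 (g := fun _ => u i) fun t ht =>
    dyadicStep_eqOn hF hi ⟨ht.1.le, ht.2.trans_le hs.2⟩]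
  simp

theorem S2_dyadicStep (hF : ∀ t ∈ Set.Ico (0 : ℝ) 1, F t = u ⌊t * 2 ^ n⌋₊) {x : ℝ}
    (hx : x ∈ Set.Ico (0 : ℝ) 1) : S2 n F x = F x := by
  rw [S2_apply n (intervalIntegrable_dyadicStep hF) hx,
    integral_dyadicStep_cell hF (floor_mul_two_pow_lt n hx)
      (Set.right_mem_Icc.2 (dyadic_le n _)), hF x hx]
  field_simp
  ring

theorem integral_dyadicStep {Z : ℕ → ℝ} (hZ : ∀ i < 2 ^ n, Z (i + 1) = Z i + u i / 2 ^ n)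
    (hF : ∀ t ∈ Set.Ico (0 : ℝ) 1, F t = u ⌊t * 2 ^ n⌋₊) {i : ℕ} (hi : i < 2 ^ n) {s : ℝ}
    (hs : s ∈ Set.Icc ((i : ℝ) / 2 ^ n) ((i + 1) / 2 ^ n)) :
    ∫ t in (0 : ℝ)..s, F t = Z i - Z 0 + (s - i / 2 ^ n) * u i := by
  have hcell : ∀ k : ℕ, k < 2 ^ n →
      IntervalIntegrable F volume ((k : ℝ) / 2 ^ n) ((k + 1) / 2 ^ n) := fun k hk => intervalIntegrable_dyadicStep_cell hF hk
  have hgrid : ∀ k : ℕ, k ≤ 2 ^ n → IntervalIntegrable F volume 0 ((k : ℝ) / 2 ^ n) ∧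
      ∫ t in (0 : ℝ)..((k : ℝ) / 2 ^ n), F t = Z k - Z 0 := by
    intro k
    induction k with
    | zero => simp
    | succ k ih =>
      intro hk
      obtain ⟨h1, h2⟩ := ih (by omega)
      have h3 := hcell k hk
      push_cast
      refine ⟨h1.trans h3, ?_⟩
      rw [← intervalIntegral.integral_add_adjacent_intervals h1 h3, h2,
        integral_dyadicStep_cell hF hk (Set.right_mem_Icc.2 (dyadic_le n k)), hZ k hk]
      ring
  obtain ⟨h1, h2⟩ := hgrid i hi.le
  have h3 : IntervalIntegrable F volume ((i : ℝ) / 2 ^ n) s := by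
    refine (hcell i hi).mono_set ?_
    rw [Set.uIcc_of_le hs.1, Set.uIcc_of_le (dyadic_le n i)]
    exact Set.Icc_subset_Icc_right hs.2
  rw [← intervalIntegral.integral_add_adjacent_intervals h1 h3, h2,
    integral_dyadicStep_cell hF hi hs]

end DyadicStep

theorem exists_forall_abs_integral_dyadic_lt {p : ℝ → ℝ} (hp : IntervalIntegrable p volume 0 1)
    {ε : ℝ} (hε : 0 < ε) :
    ∃ nstar : ℕ, ∀ n ≥ nstar, ∀ i : ℕ, i < 2 ^ n →
      |∫ t in ((i : ℝ) / 2 ^ n)..((i + 1) / 2 ^ n), p t| < ε := by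
  have hcont : ContinuousOn (fun s => ∫ t in (0 : ℝ)..s, p t) (Set.Icc 0 1) := by
    simpa [Set.uIcc_of_le (zero_le_one' ℝ)] using
      intervalIntegral.continuousOn_primitive_interval' hp Set.left_mem_uIcc
  obtain ⟨δ, hδ, hunif⟩ := Metric.uniformContinuousOn_iff.1
    (isCompact_Icc.uniformContinuousOn_of_continuous hcont) ε hε
  obtain ⟨m, hm⟩ := exists_pow_lt_of_lt_one hδ (one_half_lt_one (α := ℝ))
  refine ⟨m, fun n hn i hi => ?_⟩
  have hle : ((i : ℝ) + 1) / 2 ^ n ≤ 1 :=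
    (div_le_one (by positivity)).2 (mod_cast hi)
  have hl : (i : ℝ) / 2 ^ n ∈ Set.Icc (0 : ℝ) 1 := ⟨by positivity, (dyadic_le n i).trans hle⟩
  have hr : ((i : ℝ) + 1) / 2 ^ n ∈ Set.Icc (0 : ℝ) 1 := ⟨by positivity, hle⟩
  have hii : ∀ s ∈ Set.Icc (0 : ℝ) 1, IntervalIntegrable p volume 0 s := fun s hs => by
    refine hp.mono_set ?_
    rw [Set.uIcc_of_le hs.1, Set.uIcc_of_le zero_le_one]
    exact Set.Icc_subset_Icc_right hs.2
  have hdist : dist (((i : ℝ) + 1) / 2 ^ n) ((i : ℝ) / 2 ^ n) < δ := by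
    rw [Real.dist_eq, ← sub_div, add_sub_cancel_left, abs_of_pos (by positivity)]
    calc (1 : ℝ) / 2 ^ n = (1 / 2) ^ n := by rw [_root_.one_div_pow]
      _ ≤ (1 / 2) ^ m := pow_le_pow_of_le_one (by norm_num) (by norm_num) hn
      _ < δ := hm
  have h := hunif _ hr _ hl hdist
  rwa [Real.dist_eq, intervalIntegral.integral_interval_sub_left (hii _ hr) (hii _ hl)] at h

/-- Existence of a solution of the discretized integral equation
`ȳ_n(x) = η + S_{2^n}(∫_ξ^· (S_{2^n}q − S_{2^n}p · ȳ_n)) (x)` for all large `n`. -/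
theorem existence_discretized_solution (p q : ℝ → ℝ)
    (hpc : ContinuousOn p (Set.Ico 0 1)) (hqc : ContinuousOn q (Set.Ico 0 1))
    (hpi : IntegrableOn p (Set.Ico (0:ℝ) 1)) (hqi : IntegrableOn q (Set.Ico (0:ℝ) 1))
    (ξ : ℝ) (hξ : ξ ∈ Set.Ico (0:ℝ) 1) (η : ℝ) :
    ∃ nstar : ℕ, ∀ n ≥ nstar, ∃ c : Fin (2 ^ n) → ℝ,
      ∀ x ∈ Set.Ico (0:ℝ) 1,
        (∑ k : Fin (2 ^ n), c k * walsh k.1 x) =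
          η + S2 n (fun s => ∫ t in ξ..s,
            (S2 n q t - S2 n p t * ∑ k : Fin (2 ^ n), c k * walsh k.1 t)) x := by
  have hp := (intervalIntegrable_iff_integrableOn_Ico_of_le (zero_le_one' ℝ)).2 hpi
  have hq := (intervalIntegrable_iff_integrableOn_Ico_of_le (zero_le_one' ℝ)).2 hqi
  obtain ⟨nstar, hsmall⟩ := exists_forall_abs_integral_dyadic_lt hp two_pos
  refine ⟨nstar, fun n hn => ?_⟩
  have hpow : (0 : ℝ) < 2 ^ n := by positivity
  let a : ℕ → ℝ := fun i => ∫ t in ((i : ℝ) / 2 ^ n)..((i + 1) / 2 ^ n), p t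
  let b : ℕ → ℝ := fun i => ∫ t in ((i : ℝ) / 2 ^ n)..((i + 1) / 2 ^ n), q t
  have hξ0 : 0 ≤ ξ * 2 ^ n := mul_nonneg hξ.1 hpow.le
  have hξI := (floor_mul_two_pow_eq_iff n hξ.1 _).1 rfl
  have hj := floor_mul_two_pow_lt n hξ
  set j := ⌊ξ * 2 ^ n⌋₊ with hj_def
  obtain ⟨Z, y, hZ, hy, hη⟩ := exists_trapezoid_recursion a b (2 ^ n) (hsmall n hn) hj
    (θ := ξ * 2 ^ n - j)
    ⟨sub_nonneg.2 (Nat.floor_le hξ0), by linarith [Nat.lt_floor_add_one (ξ * 2 ^ n)]⟩ η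
  let Y : ℝ → ℝ := fun t => y ⌊t * 2 ^ n⌋₊
  have hY : ∀ x ∈ Set.Ico (0 : ℝ) 1,
      ∑ k : Fin (2 ^ n), fcoef Y k * walsh k.1 x = Y x := fun x hx => by
    rw [Fin.sum_univ_eq_sum_range (fun k => fcoef Y k * walsh k x)]
    exact S2_dyadicStep (u := y) (fun _ _ => rfl) hx
  refine ⟨fun k => fcoef Y k, fun x hx => ?_⟩
  rw [hY x hx]
  set F : ℝ → ℝ := fun t => S2 n q t - S2 n p t *
    ∑ k : Fin (2 ^ n), fcoef Y k * walsh k.1 t with hF_def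
  let u : ℕ → ℝ := fun i => 2 ^ n * (b i - a i * y i)
  have hF : ∀ t ∈ Set.Ico (0 : ℝ) 1, F t = u ⌊t * 2 ^ n⌋₊ := fun t ht => by
    simp only [hF_def, hY t ht, S2_apply n hp ht, S2_apply n hq ht, u, a, b, Y]
    ring
  have hZu : ∀ i < 2 ^ n, Z (i + 1) = Z i + u i / 2 ^ n := fun i hi => by
    rw [hZ i hi, mul_div_cancel_left₀ _ hpow.ne']
  have hFi := intervalIntegrable_dyadicStep hF
  have hsubint : ∀ s ∈ Set.Icc (0 : ℝ) 1, IntervalIntegrable F volume 0 s := fun s hs => by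
    refine hFi.mono_set ?_
    rw [Set.uIcc_of_le hs.1, Set.uIcc_of_le zero_le_one]
    exact Set.Icc_subset_Icc_right hs.2
  have hξint : ∫ t in (0 : ℝ)..ξ, F t = η - Z 0 := by
    rw [integral_dyadicStep hZu hF hj (Set.Ico_subset_Icc_self hξI), ← hη]
    simp only [u]
    field_simp
    ring
  have hprim : IntervalIntegrable (fun s => ∫ t in ξ..s, F t) volume 0 1 := by
    refine ContinuousOn.intervalIntegrable
      (intervalIntegral.continuousOn_primitive_interval' hFi ?_)
    rw [Set.uIcc_of_le zero_le_one]
    exact Set.Ico_subset_Icc_self hξ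
  have hi := floor_mul_two_pow_lt n hx
  rw [S2_apply n hprim hx]
  simp only [Y]
  set i := ⌊x * 2 ^ n⌋₊
  have hle1 : ((i : ℝ) + 1) / 2 ^ n ≤ 1 := (div_le_one hpow).2 (mod_cast hi)
  have hlin : ∫ s in ((i : ℝ) / 2 ^ n)..((i + 1) / 2 ^ n), ∫ t in ξ..s, F t =
      ∫ s in ((i : ℝ) / 2 ^ n)..((i + 1) / 2 ^ n), ((Z i - η - i / 2 ^ n * u i) + s * u i) := by
    refine intervalIntegral.integral_congr fun s hs => ?_
    rw [Set.uIcc_of_le (dyadic_le n i)] at hs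
    have hs0 : 0 ≤ s := le_trans (by positivity) hs.1
    have h := integral_dyadicStep hZu hF hi hs
    rw [← intervalIntegral.integral_interval_sub_left (hsubint s ⟨hs0, hs.2.trans hle1⟩)
      (hsubint ξ (Set.Ico_subset_Icc_self hξ)), h, hξint]
    ring
  rw [hlin, intervalIntegral.integral_add (by simp) (by
      exact (continuous_id.mul continuous_const).intervalIntegrable _ _),
    intervalIntegral.integral_const, intervalIntegral.integral_mul_const, integral_id, hy,
    hZu i hi, smul_eq_mul]
  field_simp
  ring
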